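/- arXiv:1304.4357 — 7 statements merged into one kernel-verified Lean document; each statement's English description precedes it below -/
import Mathlib

section
/- Let r ≤ n be positive integers, let A be an r×n integer matrix, let g be an r×r integer matrix with det g ≠ 0 (so g ∈ GL(r,ℚ)), and set B = gA. For points x, y ∈ ℂⁿ, there exists λ = (λ₁,…,λ_r) ∈ (ℂ*)^r such that y_j = (∏_{i=1}^r λ_i^{A_{ij}})·x_j for all j = 1,…,n if and only if there exists γ = (γ₁,…,γ_r) ∈ (ℂ*)^r such that y_j = (∏_{i=1}^r γ_i^{B_{ij}})·x_j for all j = 1,…,n. (Equivalently: the orbit equivalence relations on ℂⁿ induced by the (ℂ*)^r-actions with exponent matrices A and B coincide, so the corresponding quotients agree; this is Lemma 'gliso' of the paper.) -/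
theorem prod_zpow_mul_matrix {G ι κ μ : Type*} [CommGroup G] [Fintype ι] [Fintype κ]
    (M : Matrix ι κ ℤ) (N : Matrix κ μ ℤ) (γ : ι → G) (j : μ) :
    ∏ i, γ i ^ (M * N) i j = ∏ k, (∏ i, γ i ^ M i k) ^ N k j := by
  simp only [Matrix.mul_apply, ← Finset.prod_zpow, ← zpow_mul]
  rw [Finset.prod_comm]
  refine Finset.prod_congr rfl fun i _ => ?_
  exact map_sum (zpowersHom G (γ i)).toAdditiveRight (fun k => M i k * N k j) Finset.univ

theorem IsAlgClosed.exists_units_zpow_eq {K : Type*} [Field K] [IsAlgClosed K]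
    (u : Kˣ) {d : ℤ} (hd : d ≠ 0) : ∃ v : Kˣ, v ^ d = u := by
  obtain ⟨z, hz⟩ := IsAlgClosed.exists_pow_nat_eq (u : K) (Int.natAbs_pos.mpr hd)
  have hz0 : z ≠ 0 := by
    rintro rfl
    rw [zero_pow (Int.natAbs_ne_zero.mpr hd)] at hz
    exact u.ne_zero hz.symm
  have hv : Units.mk0 z hz0 ^ d.natAbs = u := Units.ext (by simpa using hz)
  rcases Int.natAbs_eq d with h | h
  · exact ⟨Units.mk0 z hz0, by rw [h, zpow_natCast, hv]⟩
  · exact ⟨(Units.mk0 z hz0)⁻¹, by rw [h, zpow_neg, inv_zpow, inv_inv, zpow_natCast, hv]⟩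

theorem exists_prod_zpow_eq_of_det_ne_zero {K ι : Type*} [Field K] [IsAlgClosed K] [Fintype ι]
    [DecidableEq ι] (g : Matrix ι ι ℤ) (hg : g.det ≠ 0) (l : ι → Kˣ) :
    ∃ γ : ι → Kˣ, ∀ i, ∏ k, γ k ^ g k i = l i := by
  choose m hm using fun i => IsAlgClosed.exists_units_zpow_eq (l i) hg
  refine ⟨fun k => ∏ i, m i ^ g.adjugate i k, fun i => ?_⟩
  rw [← prod_zpow_mul_matrix, Matrix.adjugate_mul, Finset.prod_eq_single i]
  · simpa using hm i
  · intro k _ hk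
    simp [hk]
  · simp


/-- The `(ℂ*)^r`-actions on `ℂⁿ` with exponent matrices `A` and `B = g·A`
(`g` an integer matrix with nonzero determinant, hence in `GL(r,ℚ)`)
have the same orbits: Lemma `gliso` of the paper. -/
theorem stmt_0 (r n : ℕ) (hr : 0 < r) (hn : 0 < n) (hrn : r ≤ n)
    (A : Matrix (Fin r) (Fin n) ℤ) (g : Matrix (Fin r) (Fin r) ℤ)
    (hg : g.det ≠ 0) (B : Matrix (Fin r) (Fin n) ℤ) (hB : B = g * A)
    (x y : Fin n → ℂ) :
    (∃ l : Fin r → ℂˣ, ∀ j : Fin n,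
        y j = ((∏ i : Fin r, (l i) ^ (A i j) : ℂˣ) : ℂ) * x j) ↔
    (∃ γ : Fin r → ℂˣ, ∀ j : Fin n,
        y j = ((∏ i : Fin r, (γ i) ^ (B i j) : ℂˣ) : ℂ) * x j) := by
  subst hB
  simp only [prod_zpow_mul_matrix]
  constructor
  · rintro ⟨l, hl⟩
    obtain ⟨γ, hγ⟩ := exists_prod_zpow_eq_of_det_ne_zero g hg l
    exact ⟨γ, by simpa only [hγ] using hl⟩
  · rintro ⟨γ, hγ⟩
    exact ⟨fun k => ∏ i, γ i ^ g i k, hγ⟩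
end

section
/- For any r×n integer matrix M of rank r (with r ≤ n), there exist an r×r integer matrix g with det g ≠ 0 (i.e. g ∈ GL(r,ℚ) with integer entries) and an r×n integer matrix N of rank r which is standard (d_N = 1), such that M = gN. (Lemma 'dpre' of the paper.) -/
/-- `dval M` is the gcd of (the absolute values of) all `r × r` minors of the
`r × n` integer matrix `M`.  Non-injective column choices contribute a zero
determinant and do not affect the gcd. -/
def dval {r : ℕ} {m : Type*} [Fintype m] (M : Matrix (Fin r) m ℤ) : ℕ :=
  Finset.univ.gcd fun c : Fin r → m => ((M.submatrix id c).det).natAbs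

/-- A matrix with a right inverse is standard: expand `det (N * B)` multilinearly in the columns. -/
theorem dval_eq_one_of_mul_eq_one {r : ℕ} {m : Type*} [Fintype m]
    {N : Matrix (Fin r) m ℤ} {B : Matrix m (Fin r) ℤ} (h : N * B = 1) : dval N = 1 := by
  classical
  have key : (1 : ℤ) = ∑ c : Fin r → m, (∏ i, B (c i) i) * (N.submatrix id c).det := by
    rw [← Matrix.det_one (n := Fin r), ← h, ← Matrix.det_transpose]
    have hcol : (N * B).transpose = fun i => ∑ k, B k i • N.transpose k := by
      ext i j
      simp [Matrix.mul_apply, mul_comm]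
    rw [hcol]
    refine ((Matrix.detRowAlternating (n := Fin r) (R := ℤ)).toMultilinearMap.map_sum
      (fun i k => B k i • N.transpose k)).trans (Finset.sum_congr rfl fun c _ => ?_)
    refine ((Matrix.detRowAlternating (n := Fin r) (R := ℤ)).toMultilinearMap.map_smul_univ
      (fun i => B (c i) i) (fun i => N.transpose (c i))).trans ?_
    rw [← Matrix.det_transpose (N.submatrix id c)]
    rfl
  have hdvd : (dval N : ℤ) ∣ 1 := by
    rw [key]
    refine Finset.dvd_sum fun c _ => Dvd.dvd.mul_left ?_ _
    rw [Int.natCast_dvd]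
    exact Finset.gcd_dvd (Finset.mem_univ c)
  exact Nat.dvd_one.mp (by exact_mod_cast hdvd)

/-- Every integer matrix whose rational rank is its number of rows factors through a
square matrix and a matrix with a right inverse. -/
theorem exists_eq_mul_of_rank_eq {r n : ℕ} (M : Matrix (Fin r) (Fin n) ℤ)
    (hM : (M.map ((↑) : ℤ → ℚ)).rank = r) :
    ∃ (g : Matrix (Fin r) (Fin r) ℤ) (N : Matrix (Fin r) (Fin n) ℤ)
      (B : Matrix (Fin n) (Fin r) ℤ), M = g * N ∧ N * B = 1 := by
  obtain ⟨k, bM, bN, f, a, snf⟩ :=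
    (Submodule.span ℤ (Set.range M)).smithNormalForm (Pi.basisFun ℤ (Fin n))
  let N : Matrix (Fin k) (Fin n) ℤ := fun i => bM (f i)
  let B : Matrix (Fin n) (Fin k) ℤ := fun j i => bM.repr (Pi.single j 1) (f i)
  let g : Matrix (Fin r) (Fin k) ℤ := fun i j =>
    bN.repr ⟨M i, Submodule.subset_span ⟨i, rfl⟩⟩ j * a j
  have hg : M = g * N := by
    ext i l
    have h := congrArg Subtype.val (bN.sum_repr ⟨M i, Submodule.subset_span ⟨i, rfl⟩⟩)
    have h' := congrFun h l
    simp only [Submodule.coe_sum, Submodule.coe_smul, snf, Finset.sum_apply, Pi.smul_apply,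
      smul_eq_mul] at h'
    rw [← h', Matrix.mul_apply]
    simp only [g, N, mul_assoc]
  have hB : N * B = 1 := by
    ext i j
    have h := congrArg (fun v => bM.repr v (f j)) (pi_eq_sum_univ' (bM (f i)))
    simp only [map_sum, map_smul, Finsupp.coe_finsetSum, Finset.sum_apply, Finsupp.smul_apply,
      smul_eq_mul, Module.Basis.repr_self, Finsupp.single_apply, f.injective.eq_iff] at h
    rw [Matrix.mul_apply, Matrix.one_apply, h]
  have hkr : k ≤ r := by
    have h := finrank_range_le_card (R := ℤ) M
    rw [Set.finrank, Module.finrank_eq_card_basis bN] at h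
    simpa using h
  have hrk : r ≤ k := by
    have h := Matrix.rank_mul_le_right (g.map (Int.castRingHom ℚ)) (N.map (Int.castRingHom ℚ))
    rw [← Matrix.map_mul, ← hg] at h
    exact (hM.symm.trans_le h).trans (Matrix.rank_le_height _)
  obtain rfl : k = r := le_antisymm hkr hrk
  exact ⟨g, N, B, hg, hB⟩

/-- Lemma `dpre` of the paper: every integer `r × n` matrix of rank `r`
factors as `M = g · N` with `g ∈ GL(r,ℚ)` integral and `N` standard of rank `r`. -/
theorem stmt_1 (r n : ℕ) (hr : 0 < r) (hrn : r ≤ n)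
    (M : Matrix (Fin r) (Fin n) ℤ)
    (hM : (M.map ((↑) : ℤ → ℚ)).rank = r) :
    ∃ (g : Matrix (Fin r) (Fin r) ℤ) (N : Matrix (Fin r) (Fin n) ℤ),
      g.det ≠ 0 ∧ (N.map ((↑) : ℤ → ℚ)).rank = r ∧ dval N = 1 ∧ M = g * N := by
  obtain ⟨g, N, B, rfl, hB⟩ := exists_eq_mul_of_rank_eq M hM
  have hmap : (g * N).map ((↑) : ℤ → ℚ) =
      g.map (Int.castRingHom ℚ) * N.map (Int.castRingHom ℚ) :=
    Matrix.map_mul (f := Int.castRingHom ℚ)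
  rw [hmap] at hM
  refine ⟨g, N, fun hdet => ?_, ?_, dval_eq_one_of_mul_eq_one hB, rfl⟩
  · have hdet' : (g.map (Int.castRingHom ℚ)).det = 0 := by
      rw [← RingHom.mapMatrix_apply, ← RingHom.map_det, hdet, map_zero]
    obtain ⟨v, hv, hvg⟩ := Matrix.exists_vecMul_eq_zero_iff.mpr hdet'
    have hrank : (g.map (Int.castRingHom ℚ)).rank = r :=
      le_antisymm (Matrix.rank_le_height _) (hM.symm.trans_le (Matrix.rank_mul_le_left _ _))
    have hli : LinearIndependent ℚ (g.map (Int.castRingHom ℚ)).row := by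
      rw [linearIndependent_iff_card_eq_finrank_span, Set.finrank,
        ← Matrix.rank_eq_finrank_span_row, hrank, Fintype.card_fin]
    exact hv (Matrix.vecMul_injective_iff.mpr hli (by simpa using hvg))
  · exact le_antisymm (Matrix.rank_le_height _) (hM.symm.trans_le (Matrix.rank_mul_le_right _ _))
end

section
/- Let A be an r×n integer matrix of rank r (with r ≤ n), and let f : ℤⁿ → ℤʳ be the ℤ-linear map x ↦ Ax. Then the induced ℤ-linear map ⋀ʳ f : ⋀ʳ(ℤⁿ) → ⋀ʳ(ℤʳ) on r-th exterior powers (note ⋀ʳ(ℤʳ) ≅ ℤ) is surjective if and only if A is standard, i.e. the greatest common divisor of all r×r minors of A equals 1. (Equivalence (ii) ⟺ (iii) of Proposition 'LA'.) -/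
theorem Matrix.detRowAlternating_single_one {R ι : Type*} [CommRing R] [Fintype ι]
    [DecidableEq ι] :
    Matrix.detRowAlternating (fun i : ι => (Pi.single i 1 : ι → R)) = 1 := by
  rw [← Matrix.det_one (n := ι) (R := R)]
  refine congrArg Matrix.det (Matrix.ext fun i j => ?_)
  simp [Matrix.one_apply, Pi.single_apply, eq_comm]

/-- Every alternating map in `r` variables on `R^r` is the determinant times its value on the
standard basis. -/
theorem AlternatingMap.apply_eq_det_smul {R N : Type*} [CommRing R] [AddCommGroup N] [Module R N]
    {ι : Type*} [Fintype ι] [DecidableEq ι] (g : (ι → R) [⋀^ι]→ₗ[R] N) (v : ι → ι → R) :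
    g v = (Matrix.of v).det • g (fun i => Pi.single i 1) := by
  have key : g = (LinearMap.toSpanSingleton R N
      (g fun i => Pi.single i 1)).compAlternatingMap Matrix.detRowAlternating := by
    refine Module.Basis.ext_alternating (Pi.basisFun R ι) fun σ hσ => ?_
    obtain ⟨τ, rfl⟩ : ∃ τ : Equiv.Perm ι, ⇑τ = σ :=
      ⟨Equiv.ofBijective σ (Finite.injective_iff_bijective.mp hσ), rfl⟩
    have hb : ⇑(Pi.basisFun R ι) = fun i => Pi.single i 1 := by
      ext i; simp
    have h := g.map_perm (Pi.basisFun R ι) τ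
    have h' := (Matrix.detRowAlternating (R := R)).map_perm (Pi.basisFun R ι) τ
    change g (⇑(Pi.basisFun R ι) ∘ τ) =
      (Matrix.detRowAlternating (R := R) (⇑(Pi.basisFun R ι) ∘ τ) : R) •
        g fun i => Pi.single i 1
    rw [h, h', hb, Matrix.detRowAlternating_single_one, smul_assoc, one_smul]
  exact DFunLike.congr_fun key v

/-- The ideal generated by the maximal minors is everything iff their gcd is one. -/
theorem span_minors_eq_top_iff {r : ℕ} {m : Type*} [Fintype m] (M : Matrix (Fin r) m ℤ) :
    Ideal.span (Set.range fun c : Fin r → m => (M.submatrix id c).det) = ⊤ ↔ dval M = 1 := by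
  constructor
  · intro h
    have hle : Ideal.span (Set.range fun c : Fin r → m => (M.submatrix id c).det) ≤
        Ideal.span {(dval M : ℤ)} := by
      rw [Ideal.span_le]
      rintro _ ⟨c, rfl⟩
      exact Ideal.mem_span_singleton.mpr
        (Int.natCast_dvd.mpr (Finset.gcd_dvd (Finset.mem_univ c)))
    rw [h, top_le_iff, Ideal.span_singleton_eq_top] at hle
    simpa using Int.isUnit_iff_natAbs_eq.mp hle
  · intro h
    obtain ⟨g, hg⟩ := (IsPrincipalIdealRing.principal
      (Ideal.span (Set.range fun c : Fin r → m => (M.submatrix id c).det))).principal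
    have hdvd : g.natAbs ∣ dval M := Finset.dvd_gcd fun c _ => by
      refine Int.natAbs_dvd_natAbs.mpr (Ideal.mem_span_singleton.mp ?_)
      rw [Ideal.span, ← hg]
      exact Ideal.subset_span ⟨c, rfl⟩
    rw [h, Nat.dvd_one] at hdvd
    rw [hg]
    exact Ideal.span_singleton_eq_top.mpr (Int.isUnit_iff_natAbs_eq.mpr hdvd)

/-- The image of the top exterior power is the ideal of maximal minors times the standard
generator. -/
theorem map_exteriorPower_eq_map_span_minors {r n : ℕ} (A : Matrix (Fin r) (Fin n) ℤ) :
    Submodule.map (ExteriorAlgebra.map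
        (A.mulVecLin : (Fin n → ℤ) →ₗ[ℤ] (Fin r → ℤ))).toLinearMap
        (⋀[ℤ]^r (Fin n → ℤ)) =
      Submodule.map (LinearMap.toSpanSingleton ℤ (ExteriorAlgebra ℤ (Fin r → ℤ))
        (ExteriorAlgebra.ιMulti ℤ r fun i => Pi.single i 1))
        (Ideal.span (Set.range fun c : Fin r → Fin n => (A.submatrix id c).det)) := by
  rw [← exteriorPower.ιMulti_span_fixedDegree_of_span_eq_top (hs := (Pi.basisFun ℤ (Fin n)).span_eq),
    Ideal.span, Submodule.map_span, Submodule.map_span]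
  have hval (c : Fin r → Fin n) :
      ExteriorAlgebra.map A.mulVecLin (ExteriorAlgebra.ιMulti ℤ r fun i => Pi.single (c i) 1) =
        (A.submatrix id c).det •
          ExteriorAlgebra.ιMulti ℤ r fun i : Fin r => (Pi.single i 1 : Fin r → ℤ) := by
    rw [ExteriorAlgebra.map_apply_ιMulti, AlternatingMap.apply_eq_det_smul,
      ← Matrix.det_transpose]
    congr 2
    ext i j
    simp
  congr 1
  ext x
  constructor
  · rintro ⟨_, ⟨v, hv, rfl⟩, rfl⟩
    choose c hc using fun i => hv ⟨i, rfl⟩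
    obtain rfl : v = fun i => Pi.single (c i) 1 := funext fun i => by
      rw [← hc i, Pi.basisFun_apply]
    exact ⟨_, ⟨c, rfl⟩, (hval c).symm⟩
  · rintro ⟨_, ⟨c, rfl⟩, rfl⟩
    refine ⟨_, ⟨fun i => Pi.single (c i) 1, ?_, rfl⟩, hval c⟩
    rintro _ ⟨i, rfl⟩
    exact ⟨c i, Pi.basisFun_apply ..⟩

theorem injective_toSpanSingleton_ιMulti_single (R : Type*) [CommRing R] (r : ℕ) :
    Function.Injective (LinearMap.toSpanSingleton R (ExteriorAlgebra R (Fin r → R))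
      (ExteriorAlgebra.ιMulti R r fun i => Pi.single i 1)) := by
  let f (i : ℕ) : (Fin r → R) [⋀^Fin i]→ₗ[R] R :=
    if h : i = r then h ▸ Matrix.detRowAlternating else 0
  have hf : f r = Matrix.detRowAlternating := by simp [f]
  refine Function.LeftInverse.injective (g := ExteriorAlgebra.liftAlternating f) fun a => ?_
  rw [LinearMap.toSpanSingleton_apply, map_smul, ExteriorAlgebra.liftAlternating_apply_ιMulti,
    hf, Matrix.detRowAlternating_single_one, smul_eq_mul, mul_one]

theorem exteriorPower_eq_map_top (r : ℕ) :
    ⋀[ℤ]^r (Fin r → ℤ) =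
      Submodule.map (LinearMap.toSpanSingleton ℤ (ExteriorAlgebra ℤ (Fin r → ℤ))
        (ExteriorAlgebra.ιMulti ℤ r fun i => Pi.single i 1)) ⊤ := by
  have h := map_exteriorPower_eq_map_span_minors (1 : Matrix (Fin r) (Fin r) ℤ)
  have htop : Ideal.span (Set.range fun c : Fin r → Fin r =>
      ((1 : Matrix (Fin r) (Fin r) ℤ).submatrix id c).det) = ⊤ :=
    (Ideal.eq_top_iff_one _).mpr (Ideal.subset_span ⟨id, by simp⟩)
  rw [htop, Matrix.mulVecLin_one, ExteriorAlgebra.map_id] at h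
  rw [← h]
  exact (Submodule.map_id _).symm

/-- Proposition `LA`, (ii) ⟺ (iii): for an `r × n` integer matrix `A` of rank `r`
with associated linear map `f : ℤⁿ → ℤʳ`, the induced map
`⋀ʳ f : ⋀ʳ(ℤⁿ) → ⋀ʳ(ℤʳ)` on `r`-th exterior powers is surjective (i.e. the image
of `⋀ʳ(ℤⁿ)` under the algebra map induced by `f` is all of `⋀ʳ(ℤʳ)`) iff `A` is
standard, i.e. the gcd of all `r × r` minors of `A` is `1`. -/
theorem stmt_3 (r n : ℕ) (hr : 0 < r) (hrn : r ≤ n)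
    (A : Matrix (Fin r) (Fin n) ℤ)
    (hA : (A.map ((↑) : ℤ → ℚ)).rank = r) :
    Submodule.map (ExteriorAlgebra.map
        (A.mulVecLin : (Fin n → ℤ) →ₗ[ℤ] (Fin r → ℤ))).toLinearMap
        (⋀[ℤ]^r (Fin n → ℤ)) = ⋀[ℤ]^r (Fin r → ℤ) ↔
      dval A = 1 := by
  rw [map_exteriorPower_eq_map_span_minors, exteriorPower_eq_map_top,
    (Submodule.map_injective_of_injective (injective_toSpanSingleton_ιMulti_single ℤ r)).eq_iff,
    span_minors_eq_top_iff]
end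

section
/- Let p be a prime, r ≥ 1, and let M be an r×m integer matrix such that p divides every r×r minor of M (this holds vacuously if m < r). Then there exists g ∈ SL(r,ℤ) (an r×r integer matrix with determinant 1) such that p divides every entry of the r-th row of gM. (This is the key construction in the proof of Lemma 'dpre': row-reduce the reduction of M modulo p, whose rank is strictly less than r, by an element of SL_r(𝔽_p), and lift it to SL_r(ℤ).) -/
open scoped Matrix in
/-- A matrix over a field all of whose maximal minors (with as many columns as rows) vanish has
linearly dependent rows. -/
theorem Matrix.exists_vecMul_eq_zero_of_forall_minor_eq_zero {K ι κ : Type*} [Field K]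
    [Fintype ι] [DecidableEq ι] (A : Matrix ι κ K)
    (h : ∀ c : ι → κ, (A.submatrix id c).det = 0) :
    ∃ v : ι → K, v ≠ 0 ∧ v ᵥ* A = 0 := by
  by_contra! hv
  have hspan : Submodule.span K (Set.range A.col) = ⊤ := by
    by_contra hne
    obtain ⟨f, hf, hker⟩ := Submodule.exists_le_ker_of_lt_top _ (lt_top_iff_ne_top.mpr hne)
    have hfv (x : ι → K) : f x = (fun i => f (Pi.single i 1)) ⬝ᵥ x := by
      conv_lhs => rw [pi_eq_sum_univ' x]
      simp [dotProduct, mul_comm]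
    refine hv (fun i => f (Pi.single i 1)) (fun h0 => hf ?_) ?_
    · ext x
      simpa using congr_fun h0 x
    · funext j
      exact (hfv (A.col j)).symm.trans (hker (Submodule.subset_span ⟨j, rfl⟩))
  obtain ⟨κ', a, -, ha, hli⟩ := exists_linearIndependent' K A.col
  have b := Module.Basis.mk hli (by rw [ha, hspan])
  let e := (Pi.basisFun K ι).indexEquiv b
  have hli' : LinearIndependent K (A.submatrix id (a ∘ e)).col := hli.comp e e.injective
  rw [Matrix.linearIndependent_cols_iff_isUnit, Matrix.isUnit_iff_isUnit_det, h] at hli'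
  exact not_isUnit_zero hli'

/-- A vector with an entry equal to `1` is, up to sign, any prescribed row of a matrix of
determinant `1`. -/
theorem Matrix.exists_det_eq_one_and_row_eq_units_smul {R ι : Type*} [CommRing R] [Fintype ι]
    [DecidableEq ι] (u : ι → R) {k : ι} (hk : u k = 1) (l : ι) :
    ∃ (g : Matrix ι ι R) (s : ℤˣ), g.det = 1 ∧ g l = ((s : ℤ) : R) • u := by
  let s := Equiv.Perm.sign (Equiv.swap l k)
  refine ⟨((1 : Matrix ι ι R).updateRow k (((s : ℤ) : R) • u)).submatrix (Equiv.swap l k) id,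
    s, ?_, ?_⟩
  · rw [Matrix.det_permute, ← Matrix.cramer_transpose_apply, Matrix.transpose_one,
      Matrix.cramer_one]
    simp only [Module.End.one_apply, Pi.smul_apply, hk, smul_eq_mul, mul_one]
    rw [← Int.cast_mul, ← Units.val_mul, Int.units_mul_self]
    simp
  · funext j
    simp

/-- Key step in the proof of Lemma `dpre`: if a prime `p` divides every `r × r`
minor of an `r × m` integer matrix `M` (vacuously so if `m < r`), then there is
`g ∈ SL(r,ℤ)` such that `p` divides every entry of the last (`r`-th) row
of `g·M`. -/
theorem stmt_5 (p : ℕ) (hp : p.Prime) (r m : ℕ) (hr : 0 < r)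
    (M : Matrix (Fin r) (Fin m) ℤ)
    (hdiv : ∀ c : Fin r → Fin m, (p : ℤ) ∣ (M.submatrix id c).det) :
    ∃ g : Matrix (Fin r) (Fin r) ℤ, g.det = 1 ∧
      ∀ j : Fin m, (p : ℤ) ∣ (g * M) ⟨r - 1, by omega⟩ j := by
  have : Fact p.Prime := ⟨hp⟩
  obtain ⟨v, hv, hvM⟩ := Matrix.exists_vecMul_eq_zero_of_forall_minor_eq_zero
    (M.map (Int.castRingHom (ZMod p))) fun c => by
      rw [Matrix.submatrix_map, ← RingHom.mapMatrix_apply, ← RingHom.map_det]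
      exact (ZMod.intCast_zmod_eq_zero_iff_dvd _ p).mpr (hdiv c)
  obtain ⟨k, hk⟩ := Function.ne_iff.mp hv
  choose w hw using fun i => ZMod.intCast_surjective ((v k)⁻¹ * v i)
  let u := Function.update w k 1
  have hu : ∀ i, (u i : ZMod p) = (v k)⁻¹ * v i := fun i => by
    rcases eq_or_ne i k with rfl | hik
    · simp [u, inv_mul_cancel₀ hk]
    · simp [u, hik, hw]
  obtain ⟨g, s, hg, hrow⟩ := Matrix.exists_det_eq_one_and_row_eq_units_smul u
    (Function.update_self k 1 w) (⟨r - 1, by omega⟩ : Fin r)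
  refine ⟨g, hg, fun j => ?_⟩
  have hj : ∑ i, v i * (M i j : ZMod p) = 0 := congr_fun hvM j
  rw [← ZMod.intCast_zmod_eq_zero_iff_dvd, Matrix.mul_apply, hrow]
  simp only [Pi.smul_apply, smul_eq_mul, Int.cast_sum, Int.cast_mul, hu, mul_assoc,
    ← Finset.mul_sum, hj, mul_zero]
end

section
/- Let A be an r×n integer matrix with n ≥ 2 such that d_{A_i} = 1 for every i ∈ {2,…,n} (so in particular A is standard), and let q be a prime dividing d_{A_1}. Then there exist g ∈ SL(r,ℤ) and an r×n integer matrix C such that diag(q,1,…,1)·C = g·A·diag(q,1,…,1), where the left diagonal matrix is r×r (dividing the first row by q) and the right diagonal matrix is n×n (multiplying the first column by q), and such that: C is standard, d_{C_1} = d_{A_1}/q, and d_{C_i} = 1 for every i ∈ {2,…,n}. (This is one step of the paper's well-forming process, combining Lemma 'pre1dspre' with the claims d_{C_i} = d_{A_i} = 1 for i > 1 and d_{C_1} = (1/q)·d_{A_1}.) -/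
/-- `delCol M k` is the matrix obtained from `M` by deleting its `k`-th column. -/
def delCol {r n : ℕ} (M : Matrix (Fin r) (Fin (n + 1))  ℤ) (k : Fin (n + 1)) :
    Matrix (Fin r) (Fin n) ℤ :=
  M.submatrix id k.succAbove

open Module in
theorem Matrix.exists_det_submatrix_ne_zero {K m : Type*} [Field K] [Fintype m] {r : ℕ}
    (M : Matrix (Fin r) m K) (hM : LinearIndependent K M.row) :
    ∃ c : Fin r → m, (M.submatrix id c).det ≠ 0 := by
  have hrank : finrank K (Submodule.span K (Set.range M.col)) = r := by
    rw [← Matrix.rank_eq_finrank_span_cols, hM.rank_matrix, Fintype.card_fin]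
  obtain ⟨f, hf, hli⟩ : ∃ f : Fin r → Fin r → K, (∀ i, f i ∈ Set.range M.col) ∧
      LinearIndependent K f := by
    obtain ⟨f, hf, -, hli⟩ := Submodule.exists_fun_fin_finrank_span_eq K (Set.range M.col)
    exact ⟨f ∘ Fin.cast hrank.symm, fun i => hf _, hli.comp _ (Fin.cast_injective _)⟩
  choose c hc using hf
  refine ⟨c, ?_⟩
  have hcol : (M.submatrix id c).col = f := by
    ext i j
    exact congrFun (hc i) j
  rw [← hcol, Matrix.linearIndependent_cols_iff_isUnit, Matrix.isUnit_iff_isUnit_det] at hli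
  exact hli.ne_zero

theorem exists_int_row_relation_of_dvd_minors {m : Type*} [Fintype m] {r q : ℕ} (hq : q.Prime)
    (M : Matrix (Fin r) m ℤ) (hM : ∀ c : Fin r → m, (q : ℤ) ∣ (M.submatrix id c).det) :
    ∃ w : Fin r → ℤ, (∀ j, (q : ℤ) ∣ ∑ i, w i * M i j) ∧ ∃ i, ¬ (q : ℤ) ∣ w i := by
  have : Fact q.Prime := ⟨hq⟩
  have hdep : ¬ LinearIndependent (ZMod q) (M.map (Int.cast : ℤ → ZMod q)).row := by
    intro hli
    obtain ⟨c, hc⟩ := Matrix.exists_det_submatrix_ne_zero _ hli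
    apply hc
    have h := (ZMod.intCast_zmod_eq_zero_iff_dvd _ q).2 (hM c)
    rwa [← eq_intCast (Int.castRingHom (ZMod q)), RingHom.map_det] at h
  obtain ⟨v, hv, i, hi⟩ := Fintype.not_linearIndependent_iff.1 hdep
  refine ⟨fun i => (v i).val, fun j => ?_, i, fun h => hi ?_⟩
  · rw [← ZMod.intCast_zmod_eq_zero_iff_dvd]
    simpa using congrFun hv j
  · simpa using (ZMod.intCast_zmod_eq_zero_iff_dvd _ q).2 h

open Module in
theorem exists_basis_vector_mem_of_prime {r q : ℕ} (hq : q.Prime)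
    (N : Submodule ℤ (Fin r → ℤ)) (hN : ∀ x, (q : ℤ) • x ∈ N) (w : Fin r → ℤ) (hw : w ∈ N)
    (hwq : ∃ i, ¬ (q : ℤ) ∣ w i) :
    ∃ (b : Basis (Fin r) ℤ (Fin r → ℤ)) (i : Fin r), b i ∈ N := by
  obtain ⟨n, snf⟩ := N.smithNormalForm (Pi.basisFun ℤ (Fin r))
  obtain ⟨k, hk⟩ : ∃ k, ¬ (q : ℤ) ∣ snf.a k := by
    by_contra! hall
    obtain ⟨i, hi⟩ := hwq
    apply hi
    have hsum : w = ∑ k, snf.bN.repr ⟨w, hw⟩ k • (snf.a k • snf.bM (snf.f k)) := by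
      have h := congrArg N.subtype (snf.bN.sum_repr ⟨w, hw⟩)
      simp only [map_sum, map_smul, Submodule.subtype_apply, snf.snf] at h
      exact h.symm
    rw [hsum, Finset.sum_apply]
    exact Finset.dvd_sum fun k _ => ((hall k).mul_right _).mul_left _
  have hdvd : snf.a k ∣ (q : ℤ) := by
    have h := snf.repr_apply_embedding_eq_repr_smul ⟨_, hN (snf.bM (snf.f k))⟩ (i := k)
    rw [map_smul, map_smul] at h
    simp only [Basis.repr_self, Finsupp.smul_apply, Finsupp.single_eq_same, smul_eq_mul,
      mul_one] at h
    exact ⟨_, h⟩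
  have hunit : IsUnit (snf.a k) := by
    obtain ⟨e, he⟩ := hdvd
    refine ((Nat.prime_iff_prime_int.1 hq).irreducible.isUnit_or_isUnit he).resolve_right ?_
    rintro ⟨u, rfl⟩
    exact hk ⟨↑u⁻¹, by rw [he, mul_assoc, Units.mul_inv, mul_one]⟩
  refine ⟨snf.bM, snf.f k, ?_⟩
  rw [← N.smul_mem_iff_of_isUnit hunit, ← snf.snf]
  exact (snf.bN k).2

open Module in
theorem exists_det_eq_one_row_mem {r : ℕ} (N : Submodule ℤ (Fin r → ℤ))
    (b : Basis (Fin r) ℤ (Fin r → ℤ)) (i₀ i : Fin r) (hi : b i ∈ N) :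
    ∃ g : Matrix (Fin r) (Fin r) ℤ, g.det = 1 ∧ g i₀ ∈ N := by
  let b' := b.reindex (Equiv.swap i i₀)
  have hb' : b' i₀ ∈ N := by simpa [b'] using hi
  have hu := (Pi.basisFun ℤ (Fin r)).isUnit_det b'
  rw [Pi.basisFun_det] at hu
  rcases Int.isUnit_iff.1 hu with h | h
  · exact ⟨Matrix.of b', h, hb'⟩
  · refine ⟨(Matrix.of b').updateRow i₀ ((-1 : ℤ) • b' i₀), ?_, ?_⟩
    · rw [Matrix.det_updateRow_smul]
      have : (Matrix.of b').updateRow i₀ (b' i₀) = Matrix.of b' :=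
        Matrix.updateRow_eq_self (Matrix.of b') i₀
      rw [this]
      change -1 * Matrix.det (fun i => b' i) = 1
      have h' : Matrix.det (fun i => b' i) = -1 := h
      rw [h']; norm_num
    · rw [Matrix.updateRow_self]
      exact N.smul_mem _ hb'

theorem dvd_dval_iff {r : ℕ} {m : Type*} [Fintype m] (M : Matrix (Fin r) m ℤ) (d : ℕ) :
    d ∣ dval M ↔ ∀ c : Fin r → m, (d : ℤ) ∣ (M.submatrix id c).det := by
  simp [dval, Finset.dvd_gcd_iff, Int.natCast_dvd]

theorem dval_mul_left {r : ℕ} {m : Type*} [Fintype m] (g : Matrix (Fin r) (Fin r) ℤ)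
    (M : Matrix (Fin r) m ℤ) : dval (g * M) = g.det.natAbs * dval M := by
  have h (c : Fin r → m) :
      ((g * M).submatrix id c).det.natAbs = g.det.natAbs * (M.submatrix id c).det.natAbs := by
    rw [← Matrix.submatrix_mul_equiv g M id (Equiv.refl _) c, Matrix.det_mul, Int.natAbs_mul]
    simp
  simp only [dval, h, Finset.gcd_mul_left, normalize_eq]

theorem dval_dvd_dval_submatrix {r : ℕ} {m m' : Type*} [Fintype m] [Fintype m']
    (M : Matrix (Fin r) m ℤ) (e : m' → m) : dval M ∣ dval (M.submatrix id e) :=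
  (dvd_dval_iff _ _).2 fun c => (dvd_dval_iff M _).1 dvd_rfl (e ∘ c)

theorem Matrix.det_submatrix_dvd_of_rescale {m : Type*} [DecidableEq m] {r : ℕ} {q : ℤ}
    (hq : q ≠ 0) (i₀ : Fin r) (j₀ : m) (B C : Matrix (Fin r) m ℤ)
    (h : ∀ i j, (if i = i₀ then q else 1) * C i j = B i j * if j = j₀ then q else 1)
    (c : Fin r → m) :
    (C.submatrix id c).det ∣ (B.submatrix id c).det := by
  by_cases hc : Function.Injective c
  swap
  · obtain ⟨a, b, hab, hne⟩ := Function.not_injective_iff.1 hc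
    rw [Matrix.det_zero_of_column_eq hne (M := B.submatrix id c) (by simp [hab])]
    exact dvd_zero _
  have key : q * (C.submatrix id c).det =
      (B.submatrix id c).det * ∏ k, if c k = j₀ then q else 1 := by
    have hmat : Matrix.diagonal (fun i => if i = i₀ then q else 1) * C.submatrix id c =
        B.submatrix id c * Matrix.diagonal (fun k => if c k = j₀ then q else 1) := by
      ext i k
      simpa only [Matrix.diagonal_mul, Matrix.mul_diagonal, Matrix.submatrix_apply, id_eq]
        using h i (c k)
    have hdet := congrArg Matrix.det hmat
    simpa only [Matrix.det_mul, Matrix.det_diagonal, Finset.prod_ite_eq', Finset.mem_univ,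
      if_true] using hdet
  by_cases hj : ∃ k, c k = j₀
  · obtain ⟨k, hk⟩ := hj
    have hprod : (∏ l, if c l = j₀ then q else 1) = q := by
      simp [← hk, hc.eq_iff]
    rw [hprod, mul_comm] at key
    rw [mul_right_cancel₀ hq key]
  · push Not at hj
    simp only [hj, if_false, Finset.prod_const_one, mul_one] at key
    exact ⟨q, by rw [← key, mul_comm]⟩

/-- One step of the well-forming process (Lemma `pre1dspre` together with the
claims `d_{C_i} = d_{A_i} = 1` for `i > 1` and `d_{C_1} = d_{A_1}/q`): if
`d_{A_i} = 1` for all columns `i` other than the first and `q` is a prime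
dividing `d_{A_1}`, then there are `g ∈ SL(r,ℤ)` and an integer matrix `C` with
`diag(q,1,…,1) · C = g · A · diag(q,1,…,1)`, `C` standard, `d_{C_1} = d_{A_1}/q`,
and `d_{C_i} = 1` for all `i` other than the first. -/
theorem stmt_6 (r n : ℕ) (hr : 0 < r) (hn : 1 ≤ n) (hrn : r ≤ n + 1)
    (A : Matrix (Fin r) (Fin (n + 1)) ℤ)
    (hA : ∀ i : Fin (n + 1), i ≠ 0 → dval (delCol A i) = 1)
    (q : ℕ) (hq : q.Prime) (hqd : q ∣ dval (delCol A 0)) :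
    ∃ (g : Matrix (Fin r) (Fin r) ℤ) (C : Matrix (Fin r) (Fin (n + 1)) ℤ),
      g.det = 1 ∧
      (Matrix.diagonal (fun i : Fin r => if (i : ℕ) = 0 then (q : ℤ) else 1)) * C
        = g * A *
          (Matrix.diagonal (fun j : Fin (n + 1) => if j = 0 then (q : ℤ) else 1)) ∧
      dval C = 1 ∧
      q * dval (delCol C 0) = dval (delCol A 0) ∧
      ∀ i : Fin (n + 1), i ≠ 0 → dval (delCol C i) = 1 := by
  have hq0 : (q : ℤ) ≠ 0 := by exact_mod_cast hq.ne_zero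
  let i₀ : Fin r := ⟨0, hr⟩
  have hi₀ (i : Fin r) : (i : ℕ) = 0 ↔ i = i₀ := by simp [i₀, Fin.ext_iff]
  let N : Submodule ℤ (Fin r → ℤ) :=
    { carrier := {x | ∀ j, (q : ℤ) ∣ ∑ i, x i * delCol A 0 i j}
      zero_mem' := fun j => by simp
      add_mem' := fun {x y} hx hy j => by
        simpa only [Pi.add_apply, add_mul, Finset.sum_add_distrib] using dvd_add (hx j) (hy j)
      smul_mem' := fun a x hx j => by
        simpa only [Pi.smul_apply, smul_eq_mul, mul_assoc, ← Finset.mul_sum]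
          using (hx j).mul_left a }
  obtain ⟨w, hwN, hwq⟩ :=
    exists_int_row_relation_of_dvd_minors hq (delCol A 0) ((dvd_dval_iff _ _).1 hqd)
  obtain ⟨b, i, hb⟩ := exists_basis_vector_mem_of_prime hq N
    (fun x j => by
      simp only [Pi.smul_apply, smul_eq_mul, mul_assoc, ← Finset.mul_sum]
      exact dvd_mul_right _ _) w hwN hwq
  obtain ⟨g, hg, hgN⟩ := exists_det_eq_one_row_mem N b i₀ i hb
  have hrow (j : Fin (n + 1)) (hj : j ≠ 0) : (q : ℤ) ∣ (g * A) i₀ j := by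
    obtain ⟨k, rfl⟩ := Fin.exists_succ_eq.2 hj
    simpa [Matrix.mul_apply, delCol] using hgN k
  have hdval (k : Fin (n + 1)) : dval (delCol (g * A) k) = dval (delCol A k) := by
    have : delCol (g * A) k = g * delCol A k := by
      ext i j
      simp [delCol, Matrix.mul_apply]
    rw [this, dval_mul_left, hg, Int.natAbs_one, one_mul]
  obtain ⟨C, hC⟩ : ∃ C : Matrix (Fin r) (Fin (n + 1)) ℤ, ∀ i j,
      (if i = i₀ then (q : ℤ) else 1) * C i j =
        (g * A) i j * if j = 0 then (q : ℤ) else 1 := by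
    have h (i : Fin r) (j : Fin (n + 1)) : ∃ x : ℤ,
        (if i = i₀ then (q : ℤ) else 1) * x = (g * A) i j * if j = 0 then (q : ℤ) else 1 := by
      by_cases hi : i = i₀
      · by_cases hj : j = 0
        · exact ⟨(g * A) i j, by simp [hi, hj, mul_comm]⟩
        · obtain ⟨x, hx⟩ := hrow j hj
          exact ⟨x, by simp [hi, hj, hx]⟩
      · exact ⟨_, by rw [if_neg hi, one_mul]⟩
    choose C hC using h
    exact ⟨C, hC⟩
  have hCi (i : Fin (n + 1)) (hi : i ≠ 0) : dval (delCol C i) = 1 := by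
    rw [← Nat.dvd_one, ← hA i hi, ← hdval i, dvd_dval_iff]
    exact fun c => ((dvd_dval_iff (delCol C i) _).1 dvd_rfl c).trans
      (Matrix.det_submatrix_dvd_of_rescale hq0 i₀ 0 (g * A) C hC (i.succAbove ∘ c))
  refine ⟨g, C, hg, ?_, ?_, ?_, hCi⟩
  · ext i j
    simpa only [Matrix.diagonal_mul, Matrix.mul_diagonal, hi₀] using hC i j
  · have hlast : Fin.last n ≠ 0 := Fin.ne_of_gt (Fin.lt_def.2 (by simpa using Nat.lt_of_succ_le hn))
    exact Nat.dvd_one.1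
      ((dval_dvd_dval_submatrix C (Fin.last n).succAbove).trans (hCi _ hlast).dvd)
  · have hmul : Matrix.diagonal (fun i => if i = i₀ then (q : ℤ) else 1) * delCol C 0 =
        delCol (g * A) 0 := by
      ext i j
      simpa [delCol] using hC i j.succ
    rw [← hdval 0, ← hmul, dval_mul_left, Matrix.det_diagonal]
    simp
end

section
/- Let A be an r×n integer matrix of rank r (r ≤ n) such that for every k ∈ {1,…,n} the matrix A_k, obtained by deleting the k-th column, still has rank r. Then there exist an invertible r×r matrix G with rational entries and an n×n diagonal matrix D with positive integer diagonal entries such that the matrix W = G·A·D has integer entries and is well-formed, i.e. W is standard and W_k is standard for every k ∈ {1,…,n}. (Correctness of the paper's well-forming process: every such matrix admits a well-formed model obtained by the moves of Lemma 'dpre' and Lemma 'pre1dspre'.) -/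
/-- An integer matrix whose columns span `ℤ ^ r` is standard. -/
theorem dval_eq_one_of_mulVec_surjective {r : ℕ} {m : Type*} [Fintype m]
    (M : Matrix (Fin r) m ℤ) (hM : Function.Surjective M.mulVec) : dval M = 1 := by
  classical
  choose X hX using fun j : Fin r => hM (Pi.single j 1)
  have hdet : (1 : ℤ) = ∑ c : Fin r → m, (∏ j, X j (c j)) * (M.submatrix id c).det := by
    calc (1 : ℤ) = (1 : Matrix (Fin r) (Fin r) ℤ).det := Matrix.det_one.symm
      _ = Matrix.detRowAlternating (fun j => ∑ c, X j c • M.transpose c) := by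
          rw [← Matrix.det_transpose, Matrix.transpose_one]
          congr 1
          ext j i
          have h := congrFun (hX j) i
          rw [Matrix.one_apply, Finset.sum_apply]
          rw [Pi.single_apply] at h
          simp only [eq_comm (a := j), ← h, Matrix.mulVec, dotProduct, Pi.smul_apply,
            Matrix.transpose_apply, smul_eq_mul, mul_comm]
      _ = ∑ c : Fin r → m,
            Matrix.detRowAlternating (fun j => X j (c j) • M.transpose (c j)) :=
          MultilinearMap.map_sum Matrix.detRowAlternating.toMultilinearMap
            (fun j c => X j c • M.transpose c)
      _ = _ := by
          refine Finset.sum_congr rfl fun c _ => ?_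
          rw [← Matrix.det_transpose (M.submatrix id c)]
          exact MultilinearMap.map_smul_univ Matrix.detRowAlternating.toMultilinearMap
            (fun j => X j (c j)) (fun j => M.transpose (c j))
  have hdvd : (dval M : ℤ) ∣ 1 := by
    rw [hdet]
    refine Finset.dvd_sum fun c _ => Dvd.dvd.mul_left ?_ _
    exact Int.natCast_dvd.mpr (Finset.gcd_dvd (Finset.mem_univ c))
  exact Nat.dvd_one.mp (by exact_mod_cast hdvd)

theorem mulVec_surjective_of_rank_eq {r : ℕ} {m : Type*} [Fintype m]
    (M : Matrix (Fin r) m ℚ) (hM : M.rank = r) : Function.Surjective M.mulVec := by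
  have h : LinearMap.range M.mulVecLin = ⊤ :=
    Submodule.eq_top_of_finrank_eq (by simpa [Matrix.rank] using hM)
  exact LinearMap.range_eq_top.mp h

theorem mulVec_eq_add_delCol {r n : ℕ} (M : Matrix (Fin r) (Fin (n + 1)) ℤ)
    (k : Fin (n + 1)) (x : Fin (n + 1) → ℤ) :
    M.mulVec x = x k • M.col k + (delCol M k).mulVec (fun i => x (k.succAbove i)) := by
  ext i
  simp [Matrix.mulVec, dotProduct, Fin.sum_univ_succAbove _ k, delCol, mul_comm]

/-- If deleting the `k`-th column preserves full row rank, some integer relation between the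
columns involves the `k`-th one. -/
theorem exists_mulVec_eq_zero_apply_ne_zero {r n : ℕ} (A : Matrix (Fin r) (Fin (n + 1)) ℤ)
    (k : Fin (n + 1)) (hk : ((delCol A k).map ((↑) : ℤ → ℚ)).rank = r) :
    ∃ a, A.mulVec a = 0 ∧ a k ≠ 0 := by
  obtain ⟨q, hq⟩ := mulVec_surjective_of_rank_eq _ hk (fun i => (A i k : ℚ))
  obtain ⟨⟨c, hc⟩, hcq⟩ :=
    IsLocalization.exist_integer_multiples_of_finite (nonZeroDivisors ℤ) q
  choose z hz using hcq
  refine ⟨k.insertNth c (fun i => -z i), ?_, by simpa using hc⟩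
  rw [mulVec_eq_add_delCol A k]
  ext i
  have h := congrFun hq i
  simp only [Matrix.mulVec, dotProduct, Matrix.map_apply] at h
  have hz' : ∀ j, (z j : ℚ) = c * q j := fun j => by simpa using hz j
  simp only [Fin.insertNth_apply_same, Fin.insertNth_apply_succAbove, Pi.add_apply,
    Pi.smul_apply, smul_eq_mul, Matrix.col_apply, Matrix.mulVec, dotProduct, Pi.zero_apply]
  have : ((c * A i k + ∑ x, delCol A k i x * -z x : ℤ) : ℚ) = 0 := by
    push_cast
    rw [← h, Finset.mul_sum, ← Finset.sum_add_distrib]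
    refine Finset.sum_eq_zero fun x _ => ?_
    rw [hz']
    ring
  exact_mod_cast this

/-- The `k`-th coordinates of the integer relations between the columns are the multiples of a
positive integer. -/
theorem exists_pos_generator_apply_ker {m ι : Type*} [Fintype m] (A : Matrix ι m ℤ) (k : m)
    (hk : ∃ a, A.mulVec a = 0 ∧ a k ≠ 0) :
    ∃ g : ℤ, 0 < g ∧ (∃ a, A.mulVec a = 0 ∧ a k = g) ∧ ∀ a, A.mulVec a = 0 → g ∣ a k := by
  let I : Submodule ℤ ℤ :=
    (LinearMap.ker A.mulVecLin).map (LinearMap.proj (R := ℤ) (φ := fun _ : m => ℤ) k)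
  have hmem : ∀ x, x ∈ I ↔ ∃ a, A.mulVec a = 0 ∧ a k = x := fun x => by
    simp [I, Submodule.mem_map]
  let g := Submodule.IsPrincipal.generator I
  have hdvd : ∀ a, A.mulVec a = 0 → g ∣ a k := fun a ha =>
    (Submodule.IsPrincipal.mem_iff_generator_dvd I).mp ((hmem _).mpr ⟨a, ha, rfl⟩)
  refine ⟨|g|, abs_pos.mpr ?_, (hmem _).mp ?_, fun a ha => (abs_dvd _ _).mpr (hdvd a ha)⟩
  · obtain ⟨a, ha, hak⟩ := hk
    exact fun h0 => hak (zero_dvd_iff.mp (h0 ▸ hdvd a ha))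
  · rw [Submodule.IsPrincipal.mem_iff_generator_dvd I]
    exact (dvd_abs _ _).mpr dvd_rfl

/-- An integer matrix of full row rank factors as a nonsingular square matrix times a matrix whose
columns span `ℤ ^ r`. -/
theorem exists_mul_eq_of_rank_eq {r : ℕ} {m : Type*} [Fintype m]
    (C : Matrix (Fin r) m ℤ)
    (hC : Function.Surjective (C.map ((↑) : ℤ → ℚ)).mulVec) :
    ∃ (B : Matrix (Fin r) (Fin r) ℤ) (W : Matrix (Fin r) m ℤ),
      IsUnit (B.map ((↑) : ℤ → ℚ)) ∧ B * W = C ∧ Function.Surjective W.mulVec := by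
  classical
  let L := LinearMap.range C.mulVecLin
  have key : ∀ {s : ℕ} (b : Module.Basis (Fin s) ℤ L),
      ∃ (B : Matrix (Fin r) (Fin s) ℤ) (W : Matrix (Fin s) m ℤ),
        Function.Surjective (B.map ((↑) : ℤ → ℚ)).mulVec ∧ B * W = C ∧
        Function.Surjective W.mulVec := by
    intro s b
    let B : Matrix (Fin r) (Fin s) ℤ := Matrix.of fun i j => (b j : Fin r → ℤ) i
    let W : Matrix (Fin s) m ℤ := LinearMap.toMatrix' (b.equivFun.toLinearMap ∘ₗ
      C.mulVecLin.rangeRestrict)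
    have hB : ∀ y, B.mulVec y = (b.equivFun.symm y : Fin r → ℤ) := fun y => by
      ext i
      simp [B, Matrix.mulVec, dotProduct, Module.Basis.equivFun_symm_apply, mul_comm]
    have hW : ∀ x, W.mulVec x = b.equivFun (C.mulVecLin.rangeRestrict x) := fun x => by
      simp only [W, LinearMap.toMatrix'_mulVec]
      rfl
    have hBW : B * W = C := by
      refine Matrix.ext_of_mulVec_single fun j => ?_
      rw [← Matrix.mulVec_mulVec, hB, hW, LinearEquiv.symm_apply_apply]
      rfl
    refine ⟨B, W, fun y => ?_, hBW, fun y => ?_⟩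
    · obtain ⟨x, rfl⟩ := hC y
      refine ⟨(W.map ((↑) : ℤ → ℚ)).mulVec x, ?_⟩
      rw [Matrix.mulVec_mulVec, ← hBW]
      congr 1
      exact (Matrix.map_mul (f := Int.castRingHom ℚ)).symm
    · obtain ⟨x, hx⟩ := C.mulVecLin.surjective_rangeRestrict (b.equivFun.symm y)
      exact ⟨x, by rw [hW, hx, LinearEquiv.apply_symm_apply]⟩
  have hL : Module.finrank ℤ L = r := by
    refine le_antisymm (by simpa using Submodule.finrank_le L) ?_
    obtain ⟨B, -, hB, -⟩ := key (Module.finBasis ℤ L)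
    simpa using LinearMap.finrank_le_finrank_of_surjective
      (f := (B.map ((↑) : ℤ → ℚ)).mulVecLin) hB
  obtain ⟨B, W, hB, hBW, hW⟩ := key (Module.finBasisOfFinrankEq ℤ L hL)
  exact ⟨B, W, Matrix.mulVec_surjective_iff_isUnit.mp hB, hBW, hW⟩

/-- Spanning survives the deletion of a column having coefficient `1` in some relation. -/
theorem delCol_mulVec_surjective {r n : ℕ} (W : Matrix (Fin r) (Fin (n + 1)) ℤ)
    (hW : Function.Surjective W.mulVec) (k : Fin (n + 1))
    (hk : ∃ b, W.mulVec b = 0 ∧ b k = 1) : Function.Surjective (delCol W k).mulVec := by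
  intro y
  obtain ⟨x, rfl⟩ := hW y
  obtain ⟨b, hb, hbk⟩ := hk
  have h := mulVec_eq_add_delCol W k (x - x k • b)
  refine ⟨fun i => (x - x k • b) (k.succAbove i), ?_⟩
  rw [Matrix.mulVec_sub, Matrix.mulVec_smul, hb] at h
  simpa [hbk] using h.symm

/-- Correctness of the paper's well-forming process: if `A` is an `r × (n+1)`
integer matrix of rank `r` all of whose column-deleted matrices `A_k` still have
rank `r`, then there are an invertible rational `r × r` matrix `G` and a diagonal
matrix with positive integer entries `d` such that `W = G · A · diag(d)` is an
integer matrix which is well-formed: `W` is standard and every `W_k` is standard. -/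
theorem stmt_7 (r n : ℕ) (hr : 0 < r) (hrn : r ≤ n + 1)
    (A : Matrix (Fin r) (Fin (n + 1)) ℤ)
    (hA : (A.map ((↑) : ℤ → ℚ)).rank = r)
    (hAk : ∀ k : Fin (n + 1), ((delCol A k).map ((↑) : ℤ → ℚ)).rank = r) :
    ∃ (G : Matrix (Fin r) (Fin r) ℚ) (d : Fin (n + 1) → ℤ)
      (W : Matrix (Fin r) (Fin (n + 1)) ℤ),
      IsUnit G.det ∧ (∀ i, 0 < d i) ∧
      W.map ((↑) : ℤ → ℚ)
        = G * A.map ((↑) : ℤ → ℚ) * Matrix.diagonal (fun i => (d i : ℚ)) ∧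
      dval W = 1 ∧ ∀ k : Fin (n + 1), dval (delCol W k) = 1 := by
  choose d hd hdk hdvd using fun k => exists_pos_generator_apply_ker A k
    (exists_mulVec_eq_zero_apply_ne_zero A k (hAk k))
  have hmap : (A * Matrix.diagonal d).map ((↑) : ℤ → ℚ)
      = A.map ((↑) : ℤ → ℚ) * Matrix.diagonal (fun i => (d i : ℚ)) := by
    ext i j
    simp
  have hC : Function.Surjective ((A * Matrix.diagonal d).map ((↑) : ℤ → ℚ)).mulVec := by
    intro y
    obtain ⟨x, rfl⟩ := mulVec_surjective_of_rank_eq _ hA y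
    refine ⟨fun i => (d i : ℚ)⁻¹ * x i, ?_⟩
    rw [hmap, ← Matrix.mulVec_mulVec]
    congr 1
    ext i
    have : (d i : ℚ) ≠ 0 := by exact_mod_cast (hd i).ne'
    rw [Matrix.mulVec_diagonal, mul_inv_cancel_left₀ this]
  obtain ⟨B, W, hB, hBW, hW⟩ := exists_mul_eq_of_rank_eq _ hC
  have hBdet : IsUnit (B.map ((↑) : ℤ → ℚ)).det := (Matrix.isUnit_iff_isUnit_det _).mp hB
  have hBW' : B.map ((↑) : ℤ → ℚ) * W.map ((↑) : ℤ → ℚ)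
      = A.map ((↑) : ℤ → ℚ) * Matrix.diagonal (fun i => (d i : ℚ)) := by
    rw [← hmap, ← hBW]
    exact (Matrix.map_mul (f := Int.castRingHom ℚ)).symm
  refine ⟨(B.map ((↑) : ℤ → ℚ))⁻¹, d, W, Matrix.isUnit_nonsing_inv_det _ hBdet, hd, ?_,
    dval_eq_one_of_mulVec_surjective W hW, fun k =>
    dval_eq_one_of_mulVec_surjective _ (delCol_mulVec_surjective W hW k ?_)⟩
  · rw [Matrix.mul_assoc, ← hBW', Matrix.nonsing_inv_mul_cancel_left _ _ hBdet]
  · obtain ⟨a, ha, hak⟩ := hdk k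
    choose b hb using fun i => hdvd i a ha
    refine ⟨b, ?_, mul_left_cancel₀ (hd k).ne' (by rw [← hb, hak, mul_one])⟩
    have hBdet' : B.det ≠ 0 := by
      have h := hBdet.ne_zero
      rw [show (B.map ((↑) : ℤ → ℚ)).det = (B.det : ℚ) from (Int.cast_det B).symm] at h
      exact_mod_cast h
    refine Matrix.eq_zero_of_mulVec_eq_zero hBdet' ?_
    rw [Matrix.mulVec_mulVec, hBW, ← Matrix.mulVec_mulVec, ← ha]
    congr 1
    ext i
    rw [Matrix.mulVec_diagonal, hb]
end

section
/- Fix m ≥ 1 and k ∈ {0,…,m}, and work in the polynomial ring ℂ[X₀, X₁, Y₀, …, Y_m, ξ]. Then the ideal generated by the monomials X₁·Y_i·Y_k for all i ≠ k, X₀·X₁·Y_k, X₁·Y_i·ξ for all i ≠ k, and X₀·Y_i·ξ for all i ∈ {0,…,m}, is equal to the intersection of ideals (X₀, X₁) ∩ (Y₀, …, Y_m) ∩ (ξ, X₁) ∩ (ξ, Y_k) ∩ (X₀, Y₀, …, Ŷ_k, …, Y_m), where Ŷ_k means Y_k is omitted from the last ideal. (This is the primary decomposition computation in the proof of Proposition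 3.7, identifying the irrelevant ideal of the blow up T of the weighted bundle ℱ at the torus-fixed point.) -/
/-- The variable `X₀` or `X₁` in the polynomial ring `ℂ[X₀,X₁,Y₀,…,Y_m,ξ]`. -/
noncomputable def Xv (m : ℕ) (i : Fin 2) : MvPolynomial (Fin 2 ⊕ Fin (m + 1) ⊕ Unit) ℂ :=
  MvPolynomial.X (Sum.inl i)

/-- The variable `Yⱼ` in the polynomial ring `ℂ[X₀,X₁,Y₀,…,Y_m,ξ]`. -/
noncomputable def Yv (m : ℕ) (j : Fin (m + 1)) : MvPolynomial (Fin 2 ⊕ Fin (m + 1) ⊕ Unit) ℂ :=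
  MvPolynomial.X (Sum.inr (Sum.inl j))

/-- The variable `ξ` in the polynomial ring `ℂ[X₀,X₁,Y₀,…,Y_m,ξ]`. -/
noncomputable def Xiv (m : ℕ) : MvPolynomial (Fin 2 ⊕ Fin (m + 1) ⊕ Unit) ℂ :=
  MvPolynomial.X (Sum.inr (Sum.inr ()))

open MvPolynomial in
/-- A monomial in which three distinct variables occur is divisible by their product. -/
theorem X_mul_X_mul_X_dvd_monomial {σ R : Type*} [CommSemiring R] {a b c : σ} {d : σ →₀ ℕ} (r : R)
    (hab : a ≠ b) (hac : a ≠ c) (hbc : b ≠ c) (ha : d a ≠ 0) (hb : d b ≠ 0) (hc : d c ≠ 0) :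
    (X a * X b * X c : MvPolynomial σ R) ∣ monomial d r := by
  classical
  have h : (X a * X b * X c : MvPolynomial σ R)
      = monomial (Finsupp.single a 1 + Finsupp.single b 1 + Finsupp.single c 1) 1 := by
    simp [X, monomial_mul]
  rw [h, monomial_dvd_monomial]
  refine ⟨Or.inr fun x => ?_, one_dvd r⟩
  simp only [Finsupp.add_apply, Finsupp.single_apply]
  grind

open MvPolynomial in
/-- An ideal containing every monomial of a polynomial contains the polynomial. -/
theorem Ideal.mem_of_forall_monomial_mem {σ R : Type*} [CommSemiring R]
    {I : Ideal (MvPolynomial σ R)} {f : MvPolynomial σ R}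
    (h : ∀ d ∈ f.support, monomial d (coeff d f) ∈ I) : f ∈ I := by
  rw [f.as_sum]
  exact I.sum_mem h

open MvPolynomial in
/-- Every monomial of a polynomial in an ideal generated by variables involves one of them. -/
theorem exists_ne_zero_of_mem_span {σ R : Type*} [CommSemiring R] {S : Set (MvPolynomial σ R)}
    {s : Set σ} (hS : S ⊆ X '' s) {f : MvPolynomial σ R} (hf : f ∈ Ideal.span S) {d : σ →₀ ℕ}
    (hd : d ∈ f.support) : ∃ i ∈ s, d i ≠ 0 :=
  mem_ideal_span_X_image.mp (Ideal.span_mono hS hf) d hd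

theorem Ideal.mul_mul_mem_of_left_mem {R : Type*} [CommSemiring R] {I : Ideal R} {a b c : R}
    (ha : a ∈ I) : a * b * c ∈ I :=
  I.mul_mem_right c (I.mul_mem_right b ha)

theorem Ideal.mul_mul_mem_of_middle_mem {R : Type*} [CommSemiring R] {I : Ideal R} {a b c : R}
    (hb : b ∈ I) : a * b * c ∈ I :=
  I.mul_mem_right c (I.mul_mem_left a hb)

/-- The primary decomposition computation in the proof of Proposition 3.7: in
`ℂ[X₀,X₁,Y₀,…,Y_m,ξ]`, the ideal generated by the monomials `X₁YᵢY_k` (`i ≠ k`),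
`X₀X₁Y_k`, `X₁Yᵢξ` (`i ≠ k`) and `X₀Yᵢξ` (all `i`) equals
`(X₀,X₁) ∩ (Y₀,…,Y_m) ∩ (ξ,X₁) ∩ (ξ,Y_k) ∩ (X₀,Y₀,…,Ŷ_k,…,Y_m)`, the irrelevant
ideal of the blow up `T` of the weighted bundle `ℱ` at a torus-fixed point. -/
theorem stmt_9 (m : ℕ) (hm : 1 ≤ m) (k : Fin (m + 1)) :
    Ideal.span
        ({f | ∃ i, i ≠ k ∧ f = Xv m 1 * Yv m i * Yv m k}
          ∪ {Xv m 0 * Xv m 1 * Yv m k}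
          ∪ {f | ∃ i, i ≠ k ∧ f = Xv m 1 * Yv m i * Xiv m}
          ∪ {f | ∃ i, f = Xv m 0 * Yv m i * Xiv m})
      = Ideal.span {Xv m 0, Xv m 1}
        ⊓ Ideal.span (Set.range (Yv m))
        ⊓ Ideal.span {Xiv m, Xv m 1}
        ⊓ Ideal.span {Xiv m, Yv m k}
        ⊓ Ideal.span ({Xv m 0} ∪ {f | ∃ i, i ≠ k ∧ f = Yv m i}) := by
  apply le_antisymm
  · have hX0 : Xv m 0 ∈ Ideal.span {Xv m 0, Xv m 1} := Ideal.subset_span (by simp)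
    have hX1 : Xv m 1 ∈ Ideal.span {Xv m 0, Xv m 1} := Ideal.subset_span (by simp)
    have hY (i) : Yv m i ∈ Ideal.span (Set.range (Yv m)) := Ideal.subset_span ⟨i, rfl⟩
    have hξ : Xiv m ∈ Ideal.span {Xiv m, Xv m 1} := Ideal.subset_span (by simp)
    have hX1' : Xv m 1 ∈ Ideal.span {Xiv m, Xv m 1} := Ideal.subset_span (by simp)
    have hξ' : Xiv m ∈ Ideal.span {Xiv m, Yv m k} := Ideal.subset_span (by simp)
    have hYk : Yv m k ∈ Ideal.span {Xiv m, Yv m k} := Ideal.subset_span (by simp)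
    have hX0' : Xv m 0 ∈ Ideal.span ({Xv m 0} ∪ {f | ∃ i, i ≠ k ∧ f = Yv m i}) :=
      Ideal.subset_span (by simp)
    have hY' (i) (hi : i ≠ k) :
        Yv m i ∈ Ideal.span ({Xv m 0} ∪ {f | ∃ i, i ≠ k ∧ f = Yv m i}) :=
      Ideal.subset_span (Or.inr ⟨i, hi, rfl⟩)
    rw [Ideal.span_le]
    rintro f (((⟨i, hi, rfl⟩ | rfl) | ⟨i, hi, rfl⟩) | ⟨i, rfl⟩)
    · exact ⟨⟨⟨⟨Ideal.mul_mul_mem_of_left_mem hX1,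
        Ideal.mul_mul_mem_of_middle_mem (hY i)⟩,
        Ideal.mul_mul_mem_of_left_mem hX1'⟩,
        Ideal.mul_mem_left _ _ hYk⟩,
        Ideal.mul_mul_mem_of_middle_mem (hY' i hi)⟩
    · exact ⟨⟨⟨⟨Ideal.mul_mul_mem_of_left_mem hX0,
        Ideal.mul_mem_left _ _ (hY k)⟩,
        Ideal.mul_mul_mem_of_middle_mem hX1'⟩,
        Ideal.mul_mem_left _ _ hYk⟩,
        Ideal.mul_mul_mem_of_left_mem hX0'⟩
    · exact ⟨⟨⟨⟨Ideal.mul_mul_mem_of_left_mem hX1,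
        Ideal.mul_mul_mem_of_middle_mem (hY i)⟩,
        Ideal.mul_mul_mem_of_left_mem hX1'⟩,
        Ideal.mul_mem_left _ _ hξ'⟩,
        Ideal.mul_mul_mem_of_middle_mem (hY' i hi)⟩
    · exact ⟨⟨⟨⟨Ideal.mul_mul_mem_of_left_mem hX0,
        Ideal.mul_mul_mem_of_middle_mem (hY i)⟩,
        Ideal.mul_mem_left _ _ hξ⟩,
        Ideal.mul_mem_left _ _ hξ'⟩,
        Ideal.mul_mul_mem_of_left_mem hX0'⟩
  · rintro f ⟨⟨⟨⟨h1, h2⟩, h3⟩, h4⟩, h5⟩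
    refine Ideal.mem_of_forall_monomial_mem fun d hd => ?_
    have e1 : d (.inl 0) ≠ 0 ∨ d (.inl 1) ≠ 0 := by
      simpa using exists_ne_zero_of_mem_span (s := {.inl 0, .inl 1})
        (by simp [Set.image_pair, Xv]) h1 hd
    have e2 : ∃ i, d (.inr (.inl i)) ≠ 0 := by
      simpa using exists_ne_zero_of_mem_span (s := Set.range fun i => .inr (.inl i))
        (by rintro _ ⟨i, rfl⟩; exact ⟨_, ⟨i, rfl⟩, rfl⟩) h2 hd
    have e3 : d (.inr (.inr ())) ≠ 0 ∨ d (.inl 1) ≠ 0 := by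
      simpa using exists_ne_zero_of_mem_span (s := {.inr (.inr ()), .inl 1})
        (by simp [Set.image_pair, Xv, Xiv]) h3 hd
    have e4 : d (.inr (.inr ())) ≠ 0 ∨ d (.inr (.inl k)) ≠ 0 := by
      simpa using exists_ne_zero_of_mem_span (s := {.inr (.inr ()), .inr (.inl k)})
        (by simp [Set.image_pair, Yv, Xiv]) h4 hd
    have e5 : d (.inl 0) ≠ 0 ∨ ∃ i, i ≠ k ∧ d (.inr (.inl i)) ≠ 0 := by
      obtain ⟨_, rfl | ⟨i, hi, rfl⟩, h⟩ := exists_ne_zero_of_mem_span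
        (s := {.inl 0} ∪ {v | ∃ i, i ≠ k ∧ v = .inr (.inl i)})
        (by
          rintro _ (rfl | ⟨i, hi, rfl⟩)
          · exact ⟨_, Or.inl rfl, rfl⟩
          · exact ⟨_, Or.inr ⟨i, hi, rfl⟩, rfl⟩) h5 hd
      · exact Or.inl h
      · exact Or.inr ⟨i, hi, h⟩
    have key : (∃ i, i ≠ k ∧ d (.inl 1) ≠ 0 ∧ d (.inr (.inl i)) ≠ 0 ∧ d (.inr (.inl k)) ≠ 0) ∨
        (d (.inl 0) ≠ 0 ∧ d (.inl 1) ≠ 0 ∧ d (.inr (.inl k)) ≠ 0) ∨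
        (∃ i, i ≠ k ∧ d (.inl 1) ≠ 0 ∧ d (.inr (.inl i)) ≠ 0 ∧ d (.inr (.inr ())) ≠ 0) ∨
        ∃ i, d (.inl 0) ≠ 0 ∧ d (.inr (.inl i)) ≠ 0 ∧ d (.inr (.inr ())) ≠ 0 := by
      grind
    obtain ⟨i, hi, ha, hb, hc⟩ | ⟨ha, hb, hc⟩ | ⟨i, hi, ha, hb, hc⟩ | ⟨i, ha, hb, hc⟩ := key
    · exact Ideal.mem_of_dvd _
        (X_mul_X_mul_X_dvd_monomial _ (by simp) (by simp) (by simpa using hi) ha hb hc)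
        (Ideal.subset_span (Or.inl (Or.inl (Or.inl ⟨i, hi, rfl⟩))))
    · exact Ideal.mem_of_dvd _
        (X_mul_X_mul_X_dvd_monomial _ (by simp) (by simp) (by simp) ha hb hc)
        (Ideal.subset_span (Or.inl (Or.inl (Or.inr rfl))))
    · exact Ideal.mem_of_dvd _
        (X_mul_X_mul_X_dvd_monomial _ (by simp) (by simp) (by simp) ha hb hc)
        (Ideal.subset_span (Or.inl (Or.inr ⟨i, hi, rfl⟩)))
    · exact Ideal.mem_of_dvd _
        (X_mul_X_mul_X_dvd_monomial _ (by simp) (by simp) (by simp) ha hb hc)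
        (Ideal.subset_span (Or.inr ⟨i, rfl⟩))
end
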